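/- Define the sequence (U_n) of reals by U_0 = 1 and U_{n+1} = U_n · exp(1/U_n) for all n ∈ ℕ. Then for all k ∈ ℕ: U_{k+2} − U_k ≤ 5 + (1/2)·ln((k+3)/(k+1)). -/

import Mathlib

noncomputable def U : ℕ → ℝ
  | 0 => 1
  | n + 1 => U n * Real.exp (1 / U n)

theorem one_le_U (n : ℕ) : 1 ≤ U n := by
  induction n with
  | zero => simp [U]
  | succ n ih =>
    have h : 1 ≤ Real.exp (1 / U n) := Real.one_le_exp (one_div_nonneg.mpr (zero_le_one.trans ih))
    exact one_le_mul_of_one_le_of_one_le ih h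

theorem U_succ_sub_le_two (n : ℕ) : U (n + 1) - U n ≤ 2 := by
  have h₁ := one_le_U n
  have hpos : 0 < U n := by linarith
  have hnonneg : 0 ≤ 1 / U n := by positivity
  have hle : |1 / U n| ≤ 1 := by
    rw [abs_of_nonneg hnonneg, div_le_one hpos]
    exact h₁
  have hexp := (le_abs_self _).trans (Real.abs_exp_sub_one_le hle)
  rw [abs_of_nonneg hnonneg] at hexp
  calc U (n + 1) - U n = U n * (Real.exp (1 / U n) - 1) := by rw [U]; ring
    _ ≤ U n * (2 * (1 / U n)) := by gcongr
    _ = 2 := by field_simp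

theorem stmt_16 :
    ∀ k : ℕ, U (k + 2) - U k ≤ 5 + (1 / 2) * Real.log (((k : ℝ) + 3) / ((k : ℝ) + 1)) := by
  intro k
  have h₁ := U_succ_sub_le_two k
  have h₂ : U (k + 2) - U (k + 1) ≤ 2 := U_succ_sub_le_two (k + 1)
  have hlog : 0 ≤ Real.log (((k : ℝ) + 3) / ((k : ℝ) + 1)) := by
    apply Real.log_nonneg
    rw [one_le_div (by positivity)]
    linarith
  linarith
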